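/- Let τ ∈ ℂ with Im τ > 0 and η, Λ, M ∈ ℂ. Assign to the two one-excitation basis vectors the weight pairs w(e₀⊗e₁) = (Λ, M−2) and w(e₁⊗e₀) = (Λ−2, M), and write w(k,l) = (w₁(k,l), w₂(k,l)). Then for all z, w, λ where both sides are defined and for all index pairs (k,l), (i,j) with k+l = i+j = 1: R^{kl}_{ij}(z−w, λ+τ; Λ, M) = e^{πi( w₁(k,l)(−z−ηM) + w₂(k,l)(−w+ηΛ) )} · R^{kl}_{ij}(z−w, λ; Λ, M) · e^{πi( w₁(i,j)(z−ηM) + w₂(i,j)(w+ηΛ) )}. (This is the transformation R_{Λ,M}(z−w, λ+τ) = e^{πi(h^{(1)}(−z−ηM)+h^{(2)}(−w+ηΛ))} R_{Λ,M}(z−w, λ) e^{πi(h^{(1)}(z−ηM)+h^{(2)}(w+ηΛ))} on the one-excitation subspace.) -/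

import Mathlib

open Complex

/-- The first Jacobi theta function. -/
noncomputable def jacobiTheta1 (t τ : ℂ) : ℂ :=
  -∑' j : ℤ, Complex.exp (Real.pi * I * (j + 1/2) ^ 2 * τ +
    2 * Real.pi * I * (j + 1/2) * (t + 1/2))

/-- One-excitation R-matrix entries `R^{kl}_{ij}(z,λ;Λ,M)` (modulus `τ`,
Planck constant `η`); zero outside the weight-one index pairs. -/
noncomputable def Rone (τ η Λ M z lam : ℂ) (k l i j : Fin 2) : ℂ :=
  if k = 0 ∧ l = 1 then
    (if i = 0 ∧ j = 1 then
      jacobiTheta1 (z + η * Λ - η * M) τ * jacobiTheta1 (lam + 2 * η) τ /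
        (jacobiTheta1 (z - η * Λ - η * M) τ * jacobiTheta1 (lam + 2 * η * (1 - Λ)) τ)
    else if i = 1 ∧ j = 0 then
      -(jacobiTheta1 (lam + 2 * η + z - η * Λ - η * M) τ * jacobiTheta1 (2 * η * Λ) τ /
        (jacobiTheta1 (z - η * Λ - η * M) τ * jacobiTheta1 (lam + 2 * η * (1 - Λ)) τ))
    else 0)
  else if k = 1 ∧ l = 0 then
    (if i = 0 ∧ j = 1 then
      -(jacobiTheta1 (lam + 2 * η - z - η * Λ - η * M) τ * jacobiTheta1 (2 * η * M) τ /
        (jacobiTheta1 (z - η * Λ - η * M) τ * jacobiTheta1 (lam + 2 * η * (1 - Λ)) τ))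
    else if i = 1 ∧ j = 0 then
      jacobiTheta1 (z + η * M - η * Λ) τ * jacobiTheta1 (lam + 2 * η * (1 - Λ - M)) τ /
        (jacobiTheta1 (z - η * Λ - η * M) τ * jacobiTheta1 (lam + 2 * η * (1 - Λ)) τ)
    else 0)
  else 0


/-- Quasi-periodicity of the first Jacobi theta function. -/
lemma jacobiTheta1_add_tau (t τ : ℂ) :
    jacobiTheta1 (t + τ) τ =
      -(Complex.exp (-(Real.pi * I * τ) - 2 * Real.pi * I * t) * jacobiTheta1 t τ) := by
  unfold jacobiTheta1
  rw [← (Equiv.addRight (1 : ℤ)).tsum_eq (fun j : ℤ => Complex.exp (Real.pi * I * (j + 1/2) ^ 2 * τ +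
    2 * Real.pi * I * (j + 1/2) * (t + 1/2))), mul_neg, neg_neg, ← tsum_mul_left, ← tsum_neg]
  congr 1
  ext j
  rw [← Complex.exp_add, ← neg_one_mul, ← Complex.exp_pi_mul_I, ← Complex.exp_add,
    Complex.exp_eq_exp_iff_exists_int]
  refine ⟨0, ?_⟩
  simp only [Equiv.coe_addRight]
  push_cast
  ring

/-- Ratio of shifted theta functions. -/
lemma jacobiTheta1_ratio (a b τ c d A B : ℂ) (hA : A = a + τ) (hB : B = b + τ) :
    c * jacobiTheta1 A τ / (d * jacobiTheta1 B τ) =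
      Complex.exp (-2 * Real.pi * I * (a - b)) *
        (c * jacobiTheta1 a τ / (d * jacobiTheta1 b τ)) := by
  subst hA hB
  rw [jacobiTheta1_add_tau, jacobiTheta1_add_tau]
  have h : Complex.exp (-(Real.pi * I * τ) - 2 * Real.pi * I * a) =
      Complex.exp (-2 * Real.pi * I * (a - b)) *
        Complex.exp (-(Real.pi * I * τ) - 2 * Real.pi * I * b) := by
    rw [← Complex.exp_add]; congr 1; ring
  rw [h]
  have h0 := Complex.exp_ne_zero (-(Real.pi * I * τ) - 2 * Real.pi * I * b)
  generalize Complex.exp (-(Real.pi * I * τ) - 2 * Real.pi * I * b) = E at *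
  rw [show c * -(Complex.exp (-2 * Real.pi * I * (a - b)) * E * jacobiTheta1 a τ) =
      (-E) * (Complex.exp (-2 * Real.pi * I * (a - b)) * (c * jacobiTheta1 a τ)) by ring,
    show d * -(E * jacobiTheta1 b τ) = (-E) * (d * jacobiTheta1 b τ) by ring,
    mul_div_mul_left _ _ (neg_ne_zero.mpr h0), mul_div_assoc]

/-- Assembling exponential factors. -/
lemma exp_assemble (x y u X : ℂ) (h : u = x + y) :
    Complex.exp u * X = Complex.exp x * X * Complex.exp y := by
  rw [h, Complex.exp_add]; ring

/-- Transformation of the one-excitation R-matrix under the shift `λ → λ + τ`: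
`R_{Λ,M}(z−w,λ+τ) = e^{πi(h⁽¹⁾(−z−ηM)+h⁽²⁾(−w+ηΛ))} R_{Λ,M}(z−w,λ)
e^{πi(h⁽¹⁾(z−ηM)+h⁽²⁾(w+ηΛ))}` where the one-excitation weight pairs are
`w(e₀⊗e₁) = (Λ, M−2)` and `w(e₁⊗e₀) = (Λ−2, M)`. -/
theorem Rone_shift_lambda_tau (τ η Λ M z w lam : ℂ) (hτ : 0 < τ.im)
    (hd1 : jacobiTheta1 (z - w - η * Λ - η * M) τ ≠ 0)
    (hd2 : jacobiTheta1 (lam + 2 * η * (1 - Λ)) τ ≠ 0)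
    (hd3 : jacobiTheta1 (lam + τ + 2 * η * (1 - Λ)) τ ≠ 0) :
    ∀ k l i j : Fin 2, (k : ℕ) + (l : ℕ) = 1 → (i : ℕ) + (j : ℕ) = 1 →
      Rone τ η Λ M (z - w) (lam + τ) k l i j =
        Complex.exp (Real.pi * I *
            ((if k = 0 then Λ else Λ - 2) * (-z - η * M) +
             (if k = 0 then M - 2 else M) * (-w + η * Λ))) *
          Rone τ η Λ M (z - w) lam k l i j *
          Complex.exp (Real.pi * I *
            ((if i = 0 then Λ else Λ - 2) * (z - η * M) +
             (if i = 0 then M - 2 else M) * (w + η * Λ))) := by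
  intro k l i j hkl hij
  fin_cases k <;> fin_cases l <;> simp at hkl <;> fin_cases i <;> fin_cases j <;>
    simp at hij <;> simp only [Rone] <;> simp
  · rw [jacobiTheta1_ratio (lam + 2 * η) (lam + 2 * η * (1 - Λ)) τ _ _ _ _ (by ring) (by ring)]
    apply exp_assemble
    ring
  · rw [mul_comm (jacobiTheta1 (lam + τ + 2 * η + (z - w) - η * Λ - η * M) τ),
      mul_comm (jacobiTheta1 (lam + 2 * η + (z - w) - η * Λ - η * M) τ),
      jacobiTheta1_ratio (lam + 2 * η + (z - w) - η * Λ - η * M) (lam + 2 * η * (1 - Λ)) τ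
        _ _ _ _ (by ring) (by ring)]
    apply exp_assemble
    ring
  · rw [mul_comm (jacobiTheta1 (lam + τ + 2 * η - (z - w) - η * Λ - η * M) τ),
      mul_comm (jacobiTheta1 (lam + 2 * η - (z - w) - η * Λ - η * M) τ),
      jacobiTheta1_ratio (lam + 2 * η - (z - w) - η * Λ - η * M) (lam + 2 * η * (1 - Λ)) τ
        _ _ _ _ (by ring) (by ring)]
    apply exp_assemble
    ring
  · rw [jacobiTheta1_ratio (lam + 2 * η * (1 - Λ - M)) (lam + 2 * η * (1 - Λ)) τ
        _ _ _ _ (by ring) (by ring)]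
    apply exp_assemble
    ring
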